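/- Fix a classical agenda Φ and an odd number n ≥ 3 of agents. Φ satisfies the median property if and only if for every profile (J_1,…,J_n) of classically consistent and complete judgment sets over Φ, the majority outcome M(J) is classically consistent. -/

import Mathlib

namespace Stmt3

inductive CForm : Type
  | atom : ℕ → CForm
  | neg  : CForm → CForm
  | conj : CForm → CForm → CForm
  | disj : CForm → CForm → CForm
  | imp  : CForm → CForm → CForm
  deriving DecidableEq

def CForm.eval (v : ℕ → Bool) : CForm → Bool
  | .atom i   => v i
  | .neg φ    => !(φ.eval v)
  | .conj φ ψ => φ.eval v && ψ.eval v
  | .disj φ ψ => φ.eval v || ψ.eval v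
  | .imp φ ψ  => !(φ.eval v) || ψ.eval v

def CForm.compl : CForm → CForm
  | .neg ψ => ψ
  | φ      => .neg φ

def consistent (S : Finset CForm) : Prop := ∃ v : ℕ → Bool, ∀ φ ∈ S, φ.eval v = true

def isTautology (φ : CForm) : Prop := ∀ v, φ.eval v = true
def isContradiction (φ : CForm) : Prop := ∀ v, φ.eval v = false

def isAgenda (Φ : Finset CForm) : Prop :=
  (∀ φ ∈ Φ, φ.compl ∈ Φ) ∧ ∀ φ ∈ Φ, ¬ isTautology φ ∧ ¬ isContradiction φ

def completeOn (Φ J : Finset CForm) : Prop := ∀ φ ∈ Φ, φ ∈ J ∨ φ.compl ∈ J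

def ratProfile (n : ℕ) (Φ : Finset CForm) (J : Fin n → Finset CForm) : Prop :=
  ∀ i, J i ⊆ Φ ∧ consistent (J i) ∧ completeOn Φ (J i)

def nsupp (n : ℕ) (J : Fin n → Finset CForm) (φ : CForm) : ℕ :=
  (Finset.univ.filter (fun i => φ ∈ J i)).card

def maj (n : ℕ) (Φ : Finset CForm) (J : Fin n → Finset CForm) : Finset CForm :=
  Φ.filter (fun φ => n < 2 * nsupp n J φ)

/-- Y is minimally inconsistent: inconsistent, and all proper subsets are consistent. -/
def minimallyInconsistent (Y : Finset CForm) : Prop :=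
  ¬ consistent Y ∧ ∀ Z ⊂ Y, consistent Z

/-- The median property: every minimally inconsistent subset has cardinality at most 2. -/
def medianProperty (Φ : Finset CForm) : Prop :=
  ∀ Y ⊆ Φ, minimallyInconsistent Y → Y.card ≤ 2

theorem eval_compl (v : ℕ → Bool) (φ : CForm) : φ.compl.eval v = !(φ.eval v) := by
  cases φ <;> simp [CForm.compl, CForm.eval]

theorem exists_minimal (S : Finset CForm) : ¬ consistent S →
    ∃ Y ⊆ S, minimallyInconsistent Y := by
  induction S using Finset.strongInduction with
  | H S ih =>
    intro hS
    by_cases h : ∀ Z ⊂ S, consistent Z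
    · exact ⟨S, Finset.Subset.refl S, hS, h⟩
    · push Not at h
      obtain ⟨Z, hZ, hc⟩ := h
      obtain ⟨Y, hY, hm⟩ := ih Z hZ hc
      exact ⟨Y, hY.trans hZ.subset, hm⟩

theorem exists_common (n : ℕ) (J : Fin n → Finset CForm) (a b : CForm)
    (ha : n < 2 * nsupp n J a) (hb : n < 2 * nsupp n J b) : ∃ i, a ∈ J i ∧ b ∈ J i := by
  by_contra! h
  have hd : Disjoint (Finset.univ.filter (fun i => a ∈ J i))
      (Finset.univ.filter (fun i => b ∈ J i)) := by
    rw [Finset.disjoint_left]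
    intro i hi hi2
    simp only [Finset.mem_filter, Finset.mem_univ, true_and] at hi hi2
    exact h i hi hi2
  have h1 := Finset.card_union_of_disjoint hd
  have h2 := Finset.card_le_univ (Finset.univ.filter (fun i => a ∈ J i) ∪
      Finset.univ.filter (fun i => b ∈ J i))
  rw [Fintype.card_fin] at h2
  unfold nsupp at ha hb
  omega

theorem supp_of_reject (k : ℕ) (J : Fin (2 * k + 1) → Finset CForm) (φ : CForm)
    (T : Finset (Fin (2 * k + 1))) (hT : T.card ≤ k) (h : ∀ i, i ∉ T → φ ∈ J i) :
    2 * k + 1 < 2 * nsupp (2 * k + 1) J φ := by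
  have h1 : Tᶜ ⊆ Finset.univ.filter (fun i => φ ∈ J i) := by
    intro i hi
    simpa using h i (by simpa using hi)
  have h2 := Finset.card_le_card h1
  rw [Finset.card_compl, Fintype.card_fin] at h2
  unfold nsupp
  omega

/-- a classical agenda Φ satisfies the median property iff for every
profile of classically consistent and complete judgment sets over Φ (n odd, n ≥ 3),
the majority outcome is classically consistent. -/
theorem median_property_iff_majority_consistent
    (n : ℕ) (hodd : Odd n) (h3 : 3 ≤ n)
    (Φ : Finset CForm) (hΦ : isAgenda Φ) :
    medianProperty Φ ↔
      ∀ J : Fin n → Finset CForm, ratProfile n Φ J → consistent (maj n Φ J) := by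
  constructor
  · intro hm J hJ
    by_contra hc
    obtain ⟨Y, hY, hmin⟩ := exists_minimal _ hc
    have hmaj : ∀ y ∈ Y, y ∈ Φ ∧ n < 2 * nsupp n J y := by
      intro y hy
      simpa [maj] using hY hy
    have hcard := hm Y (fun y hy => (hmaj y hy).1) hmin
    have hsub : ∃ i, ∀ y ∈ Y, y ∈ J i := by
      rcases Y.eq_empty_or_nonempty with rfl | ⟨a, ha⟩
      · exact ⟨⟨0, by omega⟩, by simp⟩
      · by_cases hb : ∃ b ∈ Y, b ≠ a
        · obtain ⟨b, hb, hba⟩ := hb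
          obtain ⟨i, hia, hib⟩ := exists_common n J a b (hmaj a ha).2 (hmaj b hb).2
          refine ⟨i, fun y hy => ?_⟩
          by_contra hyi
          have : 2 < Y.card := Finset.two_lt_card.2
            ⟨a, ha, b, hb, y, hy, hba.symm, by rintro rfl; exact hyi hia,
              by rintro rfl; exact hyi hib⟩
          omega
        · push Not at hb
          obtain ⟨i, hia, -⟩ := exists_common n J a a (hmaj a ha).2 (hmaj a ha).2
          exact ⟨i, fun y hy => by rw [hb y hy]; exact hia⟩
    obtain ⟨i, hi⟩ := hsub
    obtain ⟨v, hv⟩ := (hJ i).2.1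
    exact hmin.1 ⟨v, fun y hy => hv y (hi y hy)⟩
  · intro H Y hY hmin
    by_contra hcard
    obtain ⟨a, ha, b, hb, c, hc, hab, hac, hbc⟩ := Finset.two_lt_card.1 (not_le.1 hcard)
    obtain ⟨va, hva⟩ := hmin.2 _ (Finset.erase_ssubset ha)
    obtain ⟨vb, hvb⟩ := hmin.2 _ (Finset.erase_ssubset hb)
    obtain ⟨vc, hvc⟩ := hmin.2 _ (Finset.erase_ssubset hc)
    obtain ⟨k, rfl⟩ := hodd
    let w : Fin (2 * k + 1) → ℕ → Bool := fun i =>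
      if i.val = 0 then va else if i.val ≤ k then vb else vc
    let J : Fin (2 * k + 1) → Finset CForm := fun i => Φ.filter (fun φ => φ.eval (w i) = true)
    have hJ : ratProfile (2 * k + 1) Φ J := by
      intro i
      refine ⟨Finset.filter_subset _ _, ⟨w i, fun φ hφ => (Finset.mem_filter.1 hφ).2⟩, ?_⟩
      intro φ hφ
      have hcφ := hΦ.1 φ hφ
      simp only [J, Finset.mem_filter, hφ, hcφ, true_and, eval_compl]
      cases φ.eval (w i) <;> simp
    obtain ⟨v, hv⟩ := H J hJ
    refine hmin.1 ⟨v, fun y hy => hv y ?_⟩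
    refine Finset.mem_filter.2 ⟨hY hy, ?_⟩
    have hmem : ∀ i, y.eval (w i) = true → y ∈ J i := fun i h =>
      Finset.mem_filter.2 ⟨hY hy, h⟩
    have ea : y ≠ a → y.eval va = true := fun h => hva y (Finset.mem_erase.2 ⟨h, hy⟩)
    have eb : y ≠ b → y.eval vb = true := fun h => hvb y (Finset.mem_erase.2 ⟨h, hy⟩)
    have ec : y ≠ c → y.eval vc = true := fun h => hvc y (Finset.mem_erase.2 ⟨h, hy⟩)
    by_cases hya : y = a
    · have e1 := eb (by rw [hya]; exact hab)
      have e2 := ec (by rw [hya]; exact hac)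
      refine supp_of_reject k J y {⟨0, by omega⟩} (by simp; omega) (fun i hi => hmem i ?_)
      have : i.val ≠ 0 := fun h0 => hi (Finset.mem_singleton.2 (Fin.ext h0))
      simp only [w, this, if_false]
      split_ifs <;> assumption
    · have e1 := ea hya
      by_cases hyb : y = b
      · have e2 := ec (by rw [hyb]; exact hbc)
        refine supp_of_reject k J y (Finset.Ioc ⟨0, by omega⟩ ⟨k, by omega⟩) (by simp)
          (fun i hi => hmem i ?_)
        simp only [Finset.mem_Ioc, Fin.lt_def, Fin.le_def] at hi
        simp only [w]
        split_ifs
        · assumption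
        · omega
        · assumption
      · have e2 := eb hyb
        refine supp_of_reject k J y (Finset.Ioi ⟨k, by omega⟩) (by simp; omega)
          (fun i hi => hmem i ?_)
        simp only [Finset.mem_Ioi, Fin.lt_def] at hi
        simp only [w]
        split_ifs
        · assumption
        · assumption
        · omega

end Stmt3
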